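/- Let 0 < ε ≤ 1/8. For every g ∈ G̃₃, multiplication by g maps each of U₀, U₁, U₂ onto itself: g·U₀ = U₀, g·U₁ = U₁, and g·U₂ = U₂. In particular U₀, U₁, U₂ are G̃₃-invariant subspaces of S⁵. -/

import Mathlib

open Matrix

noncomputable section

/-- `ξ = exp(2πi/3)`, a primitive cube root of unity. -/
def ξ : ℂ := Complex.exp (2 * Real.pi * Complex.I / 3)

/-- The cyclic permutation matrix `A`, with rows `(0,1,0)`, `(0,0,1)`, `(1,0,0)`. -/
def A : Matrix (Fin 3) (Fin 3) ℂ := !![0, 1, 0; 0, 0, 1; 1, 0, 0]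

/-- The diagonal matrix `B = diag(1, ξ, ξ²)`. -/
def B : Matrix (Fin 3) (Fin 3) ℂ := !![1, 0, 0; 0, ξ, 0; 0, 0, ξ ^ 2]

/-- The matrix `P = (1/√3)·[[1,ξ,1],[1,1,ξ],[ξ,1,1]]`. -/
def P : Matrix (Fin 3) (Fin 3) ℂ :=
  (((Real.sqrt 3 : ℝ) : ℂ))⁻¹ • !![1, ξ, 1; 1, 1, ξ; ξ, 1, 1]

/-- The group `G̃₃`: the subgroup of `U(3)` generated by `A`, `B` and the unitary scalar
matrices `z·1`, `|z| = 1`. -/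
def Gt3 : Subgroup (Matrix.unitaryGroup (Fin 3) ℂ) :=
  Subgroup.closure {U : Matrix.unitaryGroup (Fin 3) ℂ |
    (U : Matrix (Fin 3) (Fin 3) ℂ) = A ∨ (U : Matrix (Fin 3) (Fin 3) ℂ) = B ∨
      ∃ z : ℂ, ‖z‖ = 1 ∧ (U : Matrix (Fin 3) (Fin 3) ℂ) = z • (1 : Matrix (Fin 3) (Fin 3) ℂ)}

/-- Euclidean space `ℂ³`. -/
abbrev E3 := EuclideanSpace ℂ (Fin 3)

/-- Application of a `3 × 3` complex matrix to a vector in `ℂ³`. -/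
def app (M : Matrix (Fin 3) (Fin 3) ℂ) (v : E3) : E3 := Matrix.toEuclideanLin M v

/-- The unit sphere `S⁵ ⊆ ℂ³`. -/
abbrev S5 : Set E3 := Metric.sphere (0 : E3) 1

/-- The subset `U₁ = {A^k v : k ∈ ℕ, ‖v‖ = 1, |v₂|² + |v₃|² ≤ ε}` of `S⁵`. -/
def U1 (ε : ℝ) : Set S5 :=
  {w | ∃ (k : ℕ) (v : E3), ‖v‖ = 1 ∧ ‖v 1‖ ^ 2 + ‖v 2‖ ^ 2 ≤ ε ∧ (w : E3) = app (A ^ k) v}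

/-- The subset `U₂ = P · U₁` of `S⁵`. -/
def U2 (ε : ℝ) : Set S5 := {w | ∃ u ∈ U1 ε, (w : E3) = app P (u : E3)}

/-- The subset `U₀`: the closure, in `S⁵`, of the complement `S⁵ \ (U₁ ∪ U₂)`. -/
def U0 (ε : ℝ) : Set S5 := closure ((U1 ε ∪ U2 ε)ᶜ)

open scoped Pointwise Fin.CommRing

lemma app_mul (M N : Matrix (Fin 3) (Fin 3) ℂ) (v : E3) : app (M * N) v = app M (app N v) := by
  simp [app, Matrix.toLpLin_apply, Matrix.mulVec_mulVec]

lemma app_one (v : E3) : app 1 v = v := by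
  simp [app]

lemma app_apply (M : Matrix (Fin 3) (Fin 3) ℂ) (v : E3) (i : Fin 3) :
    app M v i = M i 0 * v 0 + M i 1 * v 1 + M i 2 * v 2 := by
  simp [app, Matrix.toLpLin_apply, Matrix.mulVec, dotProduct, Fin.sum_univ_three]

lemma norm_app (g : Matrix.unitaryGroup (Fin 3) ℂ) (v : E3) :
    ‖app (g : Matrix (Fin 3) (Fin 3) ℂ) v‖ = ‖v‖ := by
  have h : inner ℂ (app (g : Matrix (Fin 3) (Fin 3) ℂ) v)
      (app (g : Matrix (Fin 3) (Fin 3) ℂ) v) = inner ℂ v v := by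
    have hg : star (g : Matrix (Fin 3) (Fin 3) ℂ) * g = 1 := Matrix.UnitaryGroup.star_mul_self g
    rw [app, ← LinearMap.adjoint_inner_right, ← Matrix.toEuclideanLin_conjTranspose_eq_adjoint]
    change inner ℂ v (app (star (g : Matrix (Fin 3) (Fin 3) ℂ)) (app g v)) = _
    rw [← app_mul, hg, app_one]
  rw [@norm_eq_sqrt_re_inner ℂ, @norm_eq_sqrt_re_inner ℂ, h]

/-- The unitary group `U(3)` acts on `S⁵` by matrix multiplication. -/
instance unitaryMulAction : MulAction (Matrix.unitaryGroup (Fin 3) ℂ) S5 where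
  smul g u := ⟨app (g : Matrix (Fin 3) (Fin 3) ℂ) u, by
    rw [mem_sphere_zero_iff_norm, norm_app, norm_eq_of_mem_sphere]⟩
  one_smul u := Subtype.ext (app_one _)
  mul_smul g h u := Subtype.ext (app_mul _ _ _)

lemma coe_unitary_smul (g : Matrix.unitaryGroup (Fin 3) ℂ) (u : S5) :
    ((g • u : S5) : E3) = app (g : Matrix (Fin 3) (Fin 3) ℂ) u := rfl

instance : ContinuousConstSMul (Matrix.unitaryGroup (Fin 3) ℂ) S5 where
  continuous_const_smul g := by
    refine Continuous.subtype_mk ?_ _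
    exact (LinearMap.continuous_of_finiteDimensional
      (Matrix.toEuclideanLin (g : Matrix (Fin 3) (Fin 3) ℂ))).comp continuous_subtype_val

lemma setOf_eq_app_eq_smul (g : Matrix.unitaryGroup (Fin 3) ℂ) (S : Set S5) :
    {w : S5 | ∃ u ∈ S, (w : E3) = app (g : Matrix (Fin 3) (Fin 3) ℂ) (u : E3)} = g • S := by
  ext w
  rw [Set.mem_smul_set]
  exact exists_congr fun u => and_congr_right fun _ =>
    ⟨fun h => Subtype.ext h.symm, fun h => (congrArg Subtype.val h).symm⟩

lemma norm_ξ : ‖ξ‖ = 1 := by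
  have : ξ = Complex.exp (((2 * Real.pi / 3 : ℝ) : ℂ) * Complex.I) := by
    rw [ξ]; congr 1; push_cast; ring
  rw [this, Complex.norm_exp_ofReal_mul_I]

lemma isPrimitiveRoot_ξ : IsPrimitiveRoot ξ 3 := by
  simpa [ξ] using Complex.isPrimitiveRoot_exp 3 (by norm_num)

lemma ξ_sq : ξ ^ 2 = -1 - ξ := by
  have h := isPrimitiveRoot_ξ.geom_sum_eq_zero (by norm_num)
  simp only [Finset.sum_range_succ, Finset.sum_range_zero] at h
  linear_combination h

lemma conj_ξ : (starRingEnd ℂ) ξ = -1 - ξ := by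
  rw [← ξ_sq]
  have h1 : ξ * (starRingEnd ℂ) ξ = 1 := by
    rw [Complex.mul_conj, Complex.normSq_eq_norm_sq, norm_ξ]; simp
  have h3 : ξ ^ 3 = 1 := isPrimitiveRoot_ξ.pow_eq_one
  linear_combination ξ ^ 2 * h1 - (starRingEnd ℂ) ξ * h3

lemma A_mem_unitaryGroup : A ∈ Matrix.unitaryGroup (Fin 3) ℂ := by
  rw [Matrix.mem_unitaryGroup_iff]
  ext i j
  fin_cases i <;> fin_cases j <;>
    simp [A, Matrix.mul_apply, Fin.sum_univ_three, Matrix.star_apply]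

lemma P_mem_unitaryGroup : P ∈ Matrix.unitaryGroup (Fin 3) ℂ := by
  have h3 : ((Real.sqrt 3 : ℝ) : ℂ)⁻¹ * ((Real.sqrt 3 : ℝ) : ℂ)⁻¹ = 3⁻¹ := by
    rw [← mul_inv, ← Complex.ofReal_mul, Real.mul_self_sqrt (by norm_num)]; norm_num
  rw [Matrix.mem_unitaryGroup_iff]
  ext i j
  fin_cases i <;> fin_cases j <;>
    simp [P, Matrix.mul_apply, Fin.sum_univ_three, Matrix.star_apply, conj_ξ] <;>
    grind [ξ_sq]

lemma A_mul_P : A * P = P * A := by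
  ext i j
  fin_cases i <;> fin_cases j <;>
    simp [A, P, Matrix.mul_apply, Fin.sum_univ_three]

lemma B_mul_P : B * P = P * (A * B) := by
  have h := ξ_sq
  ext i j
  fin_cases i <;> fin_cases j <;>
    simp [A, B, P, Matrix.mul_apply, Fin.sum_univ_three] <;> grind

/-- `P` as an element of the unitary group. -/
def unitaryP : Matrix.unitaryGroup (Fin 3) ℂ := ⟨P, P_mem_unitaryGroup⟩

lemma conj_unitaryP_mem_Gt3 {g : Matrix.unitaryGroup (Fin 3) ℂ} (hg : g ∈ Gt3) :
    unitaryP⁻¹ * g * unitaryP ∈ Gt3 := by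
  suffices h : Gt3 ≤ Gt3.comap (MulAut.conj unitaryP⁻¹).toMonoidHom by simpa using h hg
  rw [Gt3, Subgroup.closure_le, ← Gt3]
  intro U hU
  suffices h : unitaryP⁻¹ * U * unitaryP ∈ Gt3 by simpa using h
  have hUG : U ∈ Gt3 := Subgroup.subset_closure hU
  rcases hU with hU | hU | ⟨z, -, hU⟩
  · have h : U * unitaryP = unitaryP * U := Subtype.ext (by simpa [hU, unitaryP] using A_mul_P)
    rwa [mul_assoc, h, inv_mul_cancel_left]
  · let a : Matrix.unitaryGroup (Fin 3) ℂ := ⟨A, A_mem_unitaryGroup⟩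
    have h : U * unitaryP = unitaryP * (a * U) := Subtype.ext (by simpa [hU, unitaryP, a] using B_mul_P)
    rw [mul_assoc, h, inv_mul_cancel_left]
    exact mul_mem (Subgroup.subset_closure (Or.inl rfl)) hUG
  · have h : U * unitaryP = unitaryP * U := Subtype.ext (by simp [hU])
    rwa [mul_assoc, h, inv_mul_cancel_left]

lemma norm_sq_eq_sum (v : E3) : ‖v‖ ^ 2 = ‖v 0‖ ^ 2 + ‖v 1‖ ^ 2 + ‖v 2‖ ^ 2 := by
  rw [EuclideanSpace.norm_sq_eq, Fin.sum_univ_three]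

lemma app_A_apply (v : E3) (i : Fin 3) : app A v i = v (i + 1) := by
  rw [app_apply]; fin_cases i <;> simp [A]

lemma app_A_pow_apply (k : ℕ) (v : E3) (i : Fin 3) : app (A ^ k) v i = v (i + (k : Fin 3)) := by
  induction k generalizing v with
  | zero => simp [app_one]
  | succ k ih => rw [pow_succ, app_mul, ih, app_A_apply, Nat.cast_succ, add_assoc]

lemma mem_U1_iff {ε : ℝ} {w : S5} : w ∈ U1 ε ↔ ∃ j, 1 - ε ≤ ‖(w : E3) j‖ ^ 2 := by
  constructor
  · rintro ⟨k, v, hv, hvε, hw⟩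
    refine ⟨-(k : Fin 3), ?_⟩
    have h := norm_sq_eq_sum v
    rw [hw, app_A_pow_apply, neg_add_cancel]
    rw [hv] at h
    linarith
  · rintro ⟨j, hj⟩
    have hA : ∀ m : ℕ, A ^ m ∈ Matrix.unitaryGroup (Fin 3) ℂ :=
      fun m => pow_mem A_mem_unitaryGroup m
    have hv : ‖app (A ^ (j : ℕ)) w‖ = 1 := by
      rw [norm_app ⟨_, hA j⟩, norm_eq_of_mem_sphere]
    refine ⟨((-j : Fin 3) : ℕ), app (A ^ (j : ℕ)) w, hv, ?_, ?_⟩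
    · have h := norm_sq_eq_sum (app (A ^ (j : ℕ)) w)
      rw [hv, app_A_pow_apply _ _ 0, zero_add, Fin.cast_val_eq_self] at h
      linarith
    · ext i
      rw [app_A_pow_apply, app_A_pow_apply, Fin.cast_val_eq_self, Fin.cast_val_eq_self,
        neg_add_cancel_right]

lemma smul_mem_U1_iff {ε : ℝ} {g : Matrix.unitaryGroup (Fin 3) ℂ} (σ : Equiv.Perm (Fin 3))
    (h : ∀ (v : E3) (i : Fin 3), ‖app (g : Matrix (Fin 3) (Fin 3) ℂ) v i‖ = ‖v (σ i)‖) (u : S5) :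
    g • u ∈ U1 ε ↔ u ∈ U1 ε := by
  simp only [mem_U1_iff, coe_unitary_smul, h]
  exact ⟨fun ⟨j, hj⟩ => ⟨σ j, hj⟩, fun ⟨j, hj⟩ => ⟨σ.symm j, by simpa using hj⟩⟩

lemma Gt3_smul_U1 (ε : ℝ) {g : Matrix.unitaryGroup (Fin 3) ℂ} (hg : g ∈ Gt3) :
    g • U1 ε = U1 ε := by
  suffices h : Gt3 ≤ MulAction.stabilizer (Matrix.unitaryGroup (Fin 3) ℂ) (U1 ε) from h hg
  rw [Gt3, Subgroup.closure_le]
  intro U hU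
  rw [SetLike.mem_coe, MulAction.mem_stabilizer_set]
  rcases hU with hU | hU | ⟨z, hz, hU⟩
  · exact smul_mem_U1_iff (Equiv.addRight 1) fun v i => by rw [hU, app_A_apply]; rfl
  · refine smul_mem_U1_iff 1 fun v i => ?_
    rw [hU, app_apply]
    fin_cases i <;> simp [B, norm_ξ]
  · refine smul_mem_U1_iff 1 fun v i => ?_
    rw [hU, app_apply]
    fin_cases i <;> simp [hz]

lemma U2_eq_smul (ε : ℝ) : U2 ε = unitaryP • U1 ε := setOf_eq_app_eq_smul unitaryP (U1 ε)

lemma Gt3_smul_U2 (ε : ℝ) {g : Matrix.unitaryGroup (Fin 3) ℂ} (hg : g ∈ Gt3) :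
    g • U2 ε = U2 ε := by
  have h : g * unitaryP = unitaryP * (unitaryP⁻¹ * g * unitaryP) := by group
  rw [U2_eq_smul, smul_smul, h, mul_smul, Gt3_smul_U1 ε (conj_unitaryP_mem_Gt3 hg)]

lemma Gt3_smul_U0 (ε : ℝ) {g : Matrix.unitaryGroup (Fin 3) ℂ} (hg : g ∈ Gt3) :
    g • U0 ε = U0 ε := by
  rw [U0, ← closure_smul, Set.smul_set_compl, Set.smul_set_union, Gt3_smul_U1 ε hg,
    Gt3_smul_U2 ε hg]

/-- The sets `U₀`, `U₁`, `U₂` are invariant under the action of `G̃₃` on `S⁵`. -/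
theorem U0_U1_U2_invariant_under_Gt3 (ε : ℝ) (hε0 : 0 < ε) (hε : ε ≤ 1 / 8)
    (g : Matrix.unitaryGroup (Fin 3) ℂ) (hg : g ∈ Gt3) :
    {w : S5 | ∃ u ∈ U0 ε, (w : E3) = app (g : Matrix (Fin 3) (Fin 3) ℂ) (u : E3)} = U0 ε ∧
    {w : S5 | ∃ u ∈ U1 ε, (w : E3) = app (g : Matrix (Fin 3) (Fin 3) ℂ) (u : E3)} = U1 ε ∧
    {w : S5 | ∃ u ∈ U2 ε, (w : E3) = app (g : Matrix (Fin 3) (Fin 3) ℂ) (u : E3)} = U2 ε := by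
  simp only [setOf_eq_app_eq_smul]
  exact ⟨Gt3_smul_U0 ε hg, Gt3_smul_U1 ε hg, Gt3_smul_U2 ε hg⟩
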